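/- Let 0<β<∞, let u be holomorphic on 𝔻 and φ a holomorphic self-map of 𝔻. Then uC_φ : B → Z_β (where B = B^1 is the classical Bloch space) is compact if and only if uC_φ maps B boundedly into Z_β, lim_{n→∞} (n+1) ‖(2u'φ' + uφ'')·φ^n‖_{ν_β} = 0, lim_{n→∞} (n+1)² ‖u·(φ')²·φ^n‖_{ν_β} = 0, and lim_{n→∞} (log n) ‖u''·φ^n‖_{ν_β} = 0. -/

import Mathlib

open Complex Filter Set

noncomputable section

/-- The open unit disk in `ℂ`. -/
def unitDisk : Set ℂ := Metric.ball 0 1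

/-- The weighted sup-norm `‖g‖_{ν_γ} = sup_{z ∈ 𝔻} (1-|z|²)^γ |g(z)|`. -/
def wnorm (γ : ℝ) (g : ℂ → ℂ) : ℝ :=
  sSup ((fun z => (1 - ‖z‖ ^ 2) ^ γ * ‖g z‖) '' unitDisk)

/-- Membership in the weighted Banach space `H^∞_{ν_β}`. -/
def MemWeighted (β : ℝ) (g : ℂ → ℂ) : Prop :=
  DifferentiableOn ℂ g unitDisk ∧
    BddAbove ((fun z => (1 - ‖z‖ ^ 2) ^ β * ‖g z‖) '' unitDisk)

/-- Membership in the Bloch type space `B^α`. -/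
def MemBloch (α : ℝ) (f : ℂ → ℂ) : Prop :=
  DifferentiableOn ℂ f unitDisk ∧
    BddAbove ((fun z => (1 - ‖z‖ ^ 2) ^ α * ‖deriv f z‖) '' unitDisk)

/-- The Bloch type norm `‖f‖_{B^α} = |f(0)| + sup_{z∈𝔻}(1-|z|²)^α |f'(z)|`. -/
def blochNorm (α : ℝ) (f : ℂ → ℂ) : ℝ :=
  ‖f 0‖ + wnorm α (deriv f)

/-- Membership in the Zygmund type space `Z_β`. -/
def MemZygmund (β : ℝ) (f : ℂ → ℂ) : Prop :=
  DifferentiableOn ℂ f unitDisk ∧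
    BddAbove ((fun z => (1 - ‖z‖ ^ 2) ^ β * ‖deriv (deriv f) z‖) '' unitDisk)

/-- The Zygmund type norm `‖f‖_{Z_β} = |f(0)| + |f'(0)| + sup_{z∈𝔻}(1-|z|²)^β |f''(z)|`. -/
def zygNorm (β : ℝ) (f : ℂ → ℂ) : ℝ :=
  ‖f 0‖ + ‖deriv f 0‖ + wnorm β (deriv (deriv f))

/-- The weighted composition operator `uC_φ f = u · (f ∘ φ)`. -/
def wcomp (u φ f : ℂ → ℂ) : ℂ → ℂ := fun z => u z * f (φ z)

/-- `uC_φ` maps `B^α` boundedly into `Z_β`. -/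
def BoundedBlochToZygmund (α β : ℝ) (u φ : ℂ → ℂ) : Prop :=
  (∀ f, MemBloch α f → MemZygmund β (wcomp u φ f)) ∧
    ∃ C > 0, ∀ f, MemBloch α f → zygNorm β (wcomp u φ f) ≤ C * blochNorm α f

/-- `uC_φ` maps `B^α` boundedly into `H^∞_{ν_β}`. -/
def BoundedBlochToWeighted (α β : ℝ) (u φ : ℂ → ℂ) : Prop :=
  (∀ f, MemBloch α f → MemWeighted β (wcomp u φ f)) ∧
    ∃ C > 0, ∀ f, MemBloch α f → wnorm β (wcomp u φ f) ≤ C * blochNorm α f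

/-- `uC_φ : B^α → Z_β` is compact: it is bounded and maps bounded sets of `B^α` to
totally bounded (equivalently, since `Z_β` is complete, relatively compact) subsets
of `Z_β`. -/
def CompactBlochToZygmund (α β : ℝ) (u φ : ℂ → ℂ) : Prop :=
  BoundedBlochToZygmund α β u φ ∧
    ∀ r : ℝ, ∀ ε : ℝ, 0 < ε → ∃ T : Finset (ℂ → ℂ),
      (∀ g ∈ T, MemZygmund β g) ∧
      ∀ f, MemBloch α f → blochNorm α f ≤ r →
        ∃ g ∈ T, zygNorm β (fun z => wcomp u φ f z - g z) ≤ ε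

/-- `uC_φ : B^α → H^∞_{ν_β}` is compact: it is bounded and maps bounded sets of `B^α`
to totally bounded (equivalently, relatively compact) subsets of `H^∞_{ν_β}`. -/
def CompactBlochToWeighted (α β : ℝ) (u φ : ℂ → ℂ) : Prop :=
  BoundedBlochToWeighted α β u φ ∧
    ∀ r : ℝ, ∀ ε : ℝ, 0 < ε → ∃ T : Finset (ℂ → ℂ),
      (∀ g ∈ T, MemWeighted β g) ∧
      ∀ f, MemBloch α f → blochNorm α f ≤ r →
        ∃ g ∈ T, wnorm β (fun z => wcomp u φ f z - g z) ≤ ε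

/-- A compact (linear, bounded, with totally bounded image of the unit ball) operator
from the subspace of `B^α` cut out by the predicate `P` into `Z_β`. -/
def IsCompactOpToZygmund (α β : ℝ) (P : (ℂ → ℂ) → Prop) (K : (ℂ → ℂ) → ℂ → ℂ) : Prop :=
  (∀ f g, P f → P g → ∀ a b : ℂ,
      K (fun z => a * f z + b * g z) = fun z => a * K f z + b * K g z) ∧
  (∀ f, P f → MemZygmund β (K f)) ∧
  (∃ C, ∀ f, P f → zygNorm β (K f) ≤ C * blochNorm α f) ∧
  (∀ ε : ℝ, 0 < ε → ∃ T : Finset (ℂ → ℂ), (∀ g ∈ T, MemZygmund β g) ∧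
      ∀ f, P f → blochNorm α f ≤ 1 → ∃ g ∈ T, zygNorm β (fun z => K f z - g z) ≤ ε)

/-- The essential norm of `uC_φ`, as an operator from the subspace of `B^α` cut out by
the predicate `P` into `Z_β`: the distance to the compact operators, the operator norm
being the supremum over the unit ball. -/
def essNormZ (α β : ℝ) (P : (ℂ → ℂ) → Prop) (u φ : ℂ → ℂ) : ℝ :=
  sInf {r | ∃ K, IsCompactOpToZygmund α β P K ∧
    r = sSup {s | ∃ f, P f ∧ blochNorm α f ≤ 1 ∧
          s = zygNorm β (fun z => wcomp u φ f z - K f z)}}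

/-- A compact (linear, bounded, with totally bounded image of the unit ball) operator
from `B^α` into `H^∞_{ν_β}`. -/
def IsCompactOpToWeighted (α β : ℝ) (K : (ℂ → ℂ) → ℂ → ℂ) : Prop :=
  (∀ f g, MemBloch α f → MemBloch α g → ∀ a b : ℂ,
      K (fun z => a * f z + b * g z) = fun z => a * K f z + b * K g z) ∧
  (∀ f, MemBloch α f → MemWeighted β (K f)) ∧
  (∃ C, ∀ f, MemBloch α f → wnorm β (K f) ≤ C * blochNorm α f) ∧
  (∀ ε : ℝ, 0 < ε → ∃ T : Finset (ℂ → ℂ), (∀ g ∈ T, MemWeighted β g) ∧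
      ∀ f, MemBloch α f → blochNorm α f ≤ 1 → ∃ g ∈ T, wnorm β (fun z => K f z - g z) ≤ ε)

/-- The essential norm of `uC_φ : B^α → H^∞_{ν_β}`. -/
def essNormW (α β : ℝ) (u φ : ℂ → ℂ) : ℝ :=
  sInf {r | ∃ K, IsCompactOpToWeighted α β K ∧
    r = sSup {s | ∃ f, MemBloch α f ∧ blochNorm α f ≤ 1 ∧
          s = wnorm β (fun z => wcomp u φ f z - K f z)}}

/-- `limsup_{|φ(z)|→1} F(z) = lim_{s→1⁻} sup {F z : z ∈ 𝔻, |φ z| > s}`.  Since the inner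
supremum is nonincreasing in `s`, the limit equals the infimum over `s ∈ [0,1)`; note
that `Real.sSup ∅ = 0`, matching the convention that the value is `0` when
`{z : |φ z| > s}` is empty for some `s < 1`. -/
def phiLimsup (φ : ℂ → ℂ) (F : ℂ → ℝ) : ℝ :=
  sInf ((fun s => sSup {y | ∃ z ∈ unitDisk, s < ‖φ z‖ ∧ y = F z}) '' Set.Ico (0:ℝ) 1)

lemma mem_unitDisk {z : ℂ} : z ∈ unitDisk ↔ ‖z‖ < 1 := by
  simp [unitDisk]

lemma isOpen_unitDisk : IsOpen unitDisk := Metric.isOpen_ball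

lemma zero_mem_unitDisk : (0 : ℂ) ∈ unitDisk := by
  simp [mem_unitDisk]

lemma weight_nonneg (γ : ℝ) {z : ℂ} (hz : z ∈ unitDisk) : 0 ≤ (1 - ‖z‖ ^ 2) ^ γ := by
  rw [mem_unitDisk] at hz
  exact Real.rpow_nonneg (by nlinarith [norm_nonneg z]) _

lemma wnorm_le {γ c : ℝ} {g : ℂ → ℂ} (h : ∀ z ∈ unitDisk, (1 - ‖z‖ ^ 2) ^ γ * ‖g z‖ ≤ c) :
    wnorm γ g ≤ c := by
  refine csSup_le ⟨_, mem_image_of_mem _ zero_mem_unitDisk⟩ ?_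
  rintro _ ⟨z, hz, rfl⟩
  exact h z hz

lemma le_wnorm {γ : ℝ} {g : ℂ → ℂ}
    (hb : BddAbove ((fun z => (1 - ‖z‖ ^ 2) ^ γ * ‖g z‖) '' unitDisk)) {z : ℂ}
    (hz : z ∈ unitDisk) : (1 - ‖z‖ ^ 2) ^ γ * ‖g z‖ ≤ wnorm γ g :=
  le_csSup hb (mem_image_of_mem (fun z => (1 - ‖z‖ ^ 2) ^ γ * ‖g z‖) hz)

lemma wnorm_nonneg (γ : ℝ) (g : ℂ → ℂ) : 0 ≤ wnorm γ g := by
  refine Real.sSup_nonneg ?_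
  rintro _ ⟨z, hz, rfl⟩
  exact mul_nonneg (weight_nonneg γ hz) (norm_nonneg _)

/-- `f` is holomorphic on the disk with `|f(0)| ≤ R` and `(1-|w|)|f'(w)| ≤ R`. -/
structure BlochBound (R : ℝ) (f : ℂ → ℂ) : Prop where
  diff : DifferentiableOn ℂ f unitDisk
  norm_zero_le : ‖f 0‖ ≤ R
  norm_deriv_mul_le : ∀ w ∈ unitDisk, ‖deriv f w‖ * (1 - ‖w‖) ≤ R

lemma MemBloch.blochBound {f : ℂ → ℂ} {R : ℝ} (hf : MemBloch 1 f) (h : blochNorm 1 f ≤ R) :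
    BlochBound R f := by
  unfold blochNorm at h
  refine ⟨hf.1, by linarith [wnorm_nonneg 1 (deriv f)], fun w hw => ?_⟩
  have h1 := le_wnorm hf.2 hw
  rw [Real.rpow_one] at h1
  rw [mem_unitDisk] at hw
  have h2 : 0 ≤ ‖deriv f w‖ * (‖w‖ * (1 - ‖w‖)) := by
    have := norm_nonneg w
    have : 0 ≤ 1 - ‖w‖ := by linarith
    positivity
  nlinarith [norm_nonneg (f 0)]

namespace BlochBound

variable {R S : ℝ} {f g : ℂ → ℂ}

lemma nonneg (hf : BlochBound R f) : 0 ≤ R := (norm_nonneg _).trans hf.norm_zero_le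

lemma weighted_deriv_le (hf : BlochBound R f) {w : ℂ} (hw : w ∈ unitDisk) :
    (1 - ‖w‖ ^ 2) ^ (1 : ℝ) * ‖deriv f w‖ ≤ 2 * R := by
  have h1 := hf.norm_deriv_mul_le w hw
  rw [Real.rpow_one]
  rw [mem_unitDisk] at hw
  have h3 : (1 + ‖w‖) * (‖deriv f w‖ * (1 - ‖w‖)) ≤ 2 * R :=
    mul_le_mul (by linarith) h1
      (mul_nonneg (norm_nonneg _) (by linarith)) (by norm_num)
  linarith

lemma memBloch (hf : BlochBound R f) : MemBloch 1 f := by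
  refine ⟨hf.diff, 2 * R, ?_⟩
  rintro _ ⟨w, hw, rfl⟩
  exact hf.weighted_deriv_le hw

lemma blochNorm_le (hf : BlochBound R f) : blochNorm 1 f ≤ 3 * R := by
  have := wnorm_le fun w hw => hf.weighted_deriv_le (w := w) hw
  have := hf.norm_zero_le
  unfold blochNorm
  linarith

lemma sub (hf : BlochBound R f) (hg : BlochBound S g) :
    BlochBound (R + S) (fun z => f z - g z) := by
  refine ⟨hf.diff.sub hg.diff, (norm_sub_le _ _).trans
    (add_le_add hf.norm_zero_le hg.norm_zero_le), fun w hw => ?_⟩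
  rw [deriv_fun_sub (hf.diff.differentiableAt (isOpen_unitDisk.mem_nhds hw))
    (hg.diff.differentiableAt (isOpen_unitDisk.mem_nhds hw))]
  have h1 := hf.norm_deriv_mul_le w hw
  have h2 := hg.norm_deriv_mul_le w hw
  rw [mem_unitDisk] at hw
  have := mul_le_mul_of_nonneg_right (norm_sub_le (deriv f w) (deriv g w)) (sub_pos.2 hw).le
  linarith

end BlochBound

/-- Cauchy estimate at a single point of the disk. -/
lemma norm_deriv_le_of_ball {f : ℂ → ℂ} (hf : DifferentiableOn ℂ f unitDisk) {w : ℂ} {t M : ℝ}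
    (ht : 0 < t) (hw : ‖w‖ + t < 1) (h : ∀ z, ‖z‖ ≤ ‖w‖ + t → ‖f z‖ ≤ M) :
    ‖deriv f w‖ ≤ M / t := by
  have hsub : ∀ z ∈ Metric.closedBall w t, ‖z‖ ≤ ‖w‖ + t := fun z hz => by
    rw [mem_closedBall_iff_norm] at hz
    have := norm_le_norm_add_norm_sub' z w
    linarith
  refine Complex.norm_deriv_le_of_forall_mem_sphere_norm_le ht ?_
    fun z hz => h z (hsub z (Metric.sphere_subset_closedBall hz))
  refine (hf.mono ?_).diffContOnCl
  rw [closure_ball w ht.ne']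
  exact fun z hz => mem_unitDisk.2 ((hsub z hz).trans_lt hw)

lemma norm_deriv_le_of_closedBall {f : ℂ → ℂ} (hf : DifferentiableOn ℂ f unitDisk)
    {s ρ δ : ℝ} (hs : s < ρ) (hρ : ρ < 1) (h : ∀ w, ‖w‖ ≤ ρ → ‖f w‖ ≤ δ) (w : ℂ)
    (hw : ‖w‖ ≤ s) : ‖deriv f w‖ ≤ δ / (ρ - s) :=
  norm_deriv_le_of_ball hf (sub_pos.2 hs) (by linarith) fun z hz => h z (by linarith)

namespace BlochBound

variable {R : ℝ} {f : ℂ → ℂ}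

lemma norm_deriv_le (hf : BlochBound R f) {w : ℂ} (hw : w ∈ unitDisk) :
    ‖deriv f w‖ ≤ R * (1 - ‖w‖)⁻¹ := by
  have := hf.norm_deriv_mul_le w hw
  rw [mem_unitDisk] at hw
  rwa [← div_eq_mul_inv, le_div_iff₀ (sub_pos.2 hw)]

lemma norm_deriv_deriv_le (hf : BlochBound R f) {w : ℂ} (hw : w ∈ unitDisk) :
    ‖deriv (deriv f) w‖ ≤ 4 * R * ((1 - ‖w‖) ^ 2)⁻¹ := by
  rw [mem_unitDisk] at hw
  have hpos : 0 < 1 - ‖w‖ := sub_pos.2 hw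
  refine (norm_deriv_le_of_ball (hf.diff.deriv isOpen_unitDisk) (t := (1 - ‖w‖) / 2)
    (M := R * ((1 - ‖w‖) / 2)⁻¹) (by linarith) (by linarith) fun z hz => ?_).trans_eq ?_
  · refine (hf.norm_deriv_le (mem_unitDisk.2 (by linarith))).trans ?_
    refine mul_le_mul_of_nonneg_left ?_ hf.nonneg
    exact inv_anti₀ (by linarith) (by linarith)
  · field_simp
    ring

lemma norm_le (hf : BlochBound R f) {w : ℂ} (hw : w ∈ unitDisk) :
    ‖f w‖ ≤ R * (1 - Real.log (1 - ‖w‖)) := by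
  rw [mem_unitDisk] at hw
  have hlt : ∀ x ∈ Icc (0 : ℝ) 1, x * ‖w‖ < 1 := fun x hx => by
    nlinarith [hx.1, hx.2, norm_nonneg w]
  have hmem : ∀ x ∈ Icc (0 : ℝ) 1, (x : ℂ) * w ∈ unitDisk := fun x hx => by
    rw [mem_unitDisk, norm_mul, Complex.norm_real, Real.norm_of_nonneg hx.1]
    exact hlt x hx
  have hder : ∀ x ∈ Icc (0 : ℝ) 1,
      HasDerivAt (fun t : ℝ => f (t * w)) (deriv f (x * w) * w) x := fun x hx => by
    have h1 := (hf.diff.differentiableAt (isOpen_unitDisk.mem_nhds (hmem x hx))).hasDerivAt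
    have h2 : HasDerivAt (fun t : ℂ => t * w) w (x : ℂ) := by
      simpa using (hasDerivAt_id (x : ℂ)).mul_const w
    exact (h1.comp (x : ℂ) h2).comp_ofReal
  have hB : ∀ x ∈ Icc (0 : ℝ) 1,
      HasDerivAt (fun t : ℝ => R * (1 - Real.log (1 - t * ‖w‖)))
        (R * (1 - x * ‖w‖)⁻¹ * ‖w‖) x := fun x hx => by
    have h1 : HasDerivAt (fun t : ℝ => 1 - t * ‖w‖) (-‖w‖) x := by
      simpa using ((hasDerivAt_id x).mul_const ‖w‖).const_sub 1
    have h2 := ((h1.log (by linarith [hlt x hx])).const_sub 1).const_mul R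
    exact h2.congr_deriv (by ring)
  have key := image_norm_le_of_norm_deriv_right_le_deriv_boundary'
    (f := fun t : ℝ => f (t * w)) (a := 0) (b := 1)
    (fun x hx => (hder x hx).continuousAt.continuousWithinAt)
    (fun x hx => (hder x (Ico_subset_Icc_self hx)).hasDerivWithinAt)
    (B := fun t : ℝ => R * (1 - Real.log (1 - t * ‖w‖)))
    (by simpa using hf.norm_zero_le)
    (fun x hx => (hB x hx).continuousAt.continuousWithinAt)
    (fun x hx => (hB x (Ico_subset_Icc_self hx)).hasDerivWithinAt)
    (fun x hx => ?_) (right_mem_Icc.2 zero_le_one)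
  · simpa using key
  · have hx' := Ico_subset_Icc_self hx
    have := hf.norm_deriv_le (hmem x hx')
    rw [norm_mul, Complex.norm_real, Real.norm_of_nonneg hx'.1] at this
    rw [norm_mul]
    exact mul_le_mul_of_nonneg_right this (norm_nonneg _)

end BlochBound

/-- The coefficient of the first derivative of `f` in the second derivative of `u · (f ∘ φ)`. -/
def coeffOne (u φ : ℂ → ℂ) (z : ℂ) : ℂ :=
  2 * deriv u z * deriv φ z + u z * deriv (deriv φ) z

/-- The coefficient of the second derivative of `f` in that of `u · (f ∘ φ)`. -/
def coeffTwo (u φ : ℂ → ℂ) (z : ℂ) : ℂ := u z * deriv φ z ^ 2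

section WeightedComposition

variable {u φ f : ℂ → ℂ} {z : ℂ}

lemma deriv_wcomp (hu : DifferentiableOn ℂ u unitDisk) (hφ : DifferentiableOn ℂ φ unitDisk)
    (hφm : MapsTo φ unitDisk unitDisk) (hf : DifferentiableOn ℂ f unitDisk)
    (hz : z ∈ unitDisk) :
    deriv (wcomp u φ f) z = deriv u z * f (φ z) + u z * (deriv f (φ z) * deriv φ z) := by
  have hu' := (hu.differentiableAt (isOpen_unitDisk.mem_nhds hz)).hasDerivAt
  have hφ' := (hφ.differentiableAt (isOpen_unitDisk.mem_nhds hz)).hasDerivAt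
  have hf' := (hf.differentiableAt (isOpen_unitDisk.mem_nhds (hφm hz))).hasDerivAt
  exact (hu'.mul (hf'.comp z hφ')).deriv

lemma deriv_deriv_wcomp (hu : DifferentiableOn ℂ u unitDisk)
    (hφ : DifferentiableOn ℂ φ unitDisk) (hφm : MapsTo φ unitDisk unitDisk)
    (hf : DifferentiableOn ℂ f unitDisk) (hz : z ∈ unitDisk) :
    deriv (deriv (wcomp u φ f)) z = deriv (deriv u) z * f (φ z)
      + coeffOne u φ z * deriv f (φ z) + coeffTwo u φ z * deriv (deriv f) (φ z) := by
  have hev : deriv (wcomp u φ f) =ᶠ[nhds z]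
      fun z => deriv u z * f (φ z) + u z * (deriv f (φ z) * deriv φ z) := by
    filter_upwards [isOpen_unitDisk.mem_nhds hz] with w hw
    exact deriv_wcomp hu hφ hφm hf hw
  have hda : ∀ {g : ℂ → ℂ} {w : ℂ}, DifferentiableOn ℂ g unitDisk → w ∈ unitDisk →
      HasDerivAt g (deriv g w) w := fun hg hw =>
    (hg.differentiableAt (isOpen_unitDisk.mem_nhds hw)).hasDerivAt
  have h := ((hda (hu.deriv isOpen_unitDisk) hz).mul ((hda hf (hφm hz)).comp z (hda hφ hz))).add
    ((hda hu hz).mul (((hda (hf.deriv isOpen_unitDisk) (hφm hz)).comp z (hda hφ hz)).mul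
      (hda (hφ.deriv isOpen_unitDisk) hz)))
  rw [hev.deriv_eq]
  refine h.deriv.trans ?_
  simp only [Function.comp, Pi.mul_apply, coeffOne, coeffTwo]
  ring

end WeightedComposition

/-- `ν_β(z) |D(z)| W(|φ(z)|) → 0` as `|φ(z)| → 1`. -/
def NullTail (β : ℝ) (φ D : ℂ → ℂ) (W : ℝ → ℝ) : Prop :=
  ∀ ε > 0, ∃ s < 1, ∀ z ∈ unitDisk, s < ‖φ z‖ →
    (1 - ‖z‖ ^ 2) ^ β * ‖D z‖ * W ‖φ z‖ ≤ ε

/-- `a n · ν_β(z) |D(z) φ(z)^n| → 0` uniformly on the disk as `n → ∞`. -/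
def NullPow (β : ℝ) (φ D : ℂ → ℂ) (a : ℕ → ℝ) : Prop :=
  ∀ ε > 0, ∀ᶠ n : ℕ in atTop, ∀ z ∈ unitDisk,
    a n * ((1 - ‖z‖ ^ 2) ^ β * ‖D z‖ * ‖φ z‖ ^ n) ≤ ε

section Tails

variable {β : ℝ} {φ D : ℂ → ℂ}

lemma nullPow_iff_tendsto (hφm : MapsTo φ unitDisk unitDisk)
    (hD : ∃ M, ∀ z ∈ unitDisk, (1 - ‖z‖ ^ 2) ^ β * ‖D z‖ ≤ M) {a : ℕ → ℝ} (ha : ∀ n, 0 ≤ a n) :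
    NullPow β φ D a ↔
      Tendsto (fun n => a n * wnorm β (fun z => D z * φ z ^ n)) atTop (nhds 0) := by
  obtain ⟨M, hM⟩ := hD
  have hnorm : ∀ n : ℕ, ∀ z, (1 - ‖z‖ ^ 2) ^ β * ‖D z * φ z ^ n‖ =
      (1 - ‖z‖ ^ 2) ^ β * ‖D z‖ * ‖φ z‖ ^ n := fun n z => by
    rw [norm_mul, norm_pow, mul_assoc]
  have hbdd : ∀ n : ℕ,
      BddAbove ((fun z => (1 - ‖z‖ ^ 2) ^ β * ‖D z * φ z ^ n‖) '' unitDisk) := fun n => by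
    refine ⟨M, ?_⟩
    rintro _ ⟨z, hz, rfl⟩
    change (1 - ‖z‖ ^ 2) ^ β * ‖D z * φ z ^ n‖ ≤ M
    rw [hnorm]
    exact (mul_le_of_le_one_right (mul_nonneg (weight_nonneg β hz) (norm_nonneg _))
      (pow_le_one₀ (norm_nonneg _) (mem_unitDisk.1 (hφm hz)).le)).trans (hM z hz)
  have hpos : ∀ n, 0 ≤ a n * wnorm β (fun z => D z * φ z ^ n) := fun n =>
    mul_nonneg (ha n) (wnorm_nonneg _ _)
  rw [tendsto_order]
  constructor
  · refine fun h => ⟨fun b hb => Eventually.of_forall fun n => hb.trans_le (hpos n),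
      fun b hb => ?_⟩
    filter_upwards [h (b / 2) (half_pos hb)] with n hn
    refine lt_of_le_of_lt ?_ (half_lt_self hb)
    rcases (ha n).eq_or_lt with h0 | h0
    · rw [← h0, zero_mul]
      exact (half_pos hb).le
    · rw [mul_comm, ← le_div_iff₀ h0]
      refine wnorm_le fun z hz => ?_
      rw [le_div_iff₀ h0, mul_comm, hnorm]
      exact hn z hz
  · intro h ε hε
    filter_upwards [h.2 ε hε] with n hn z hz
    rw [← hnorm]
    exact (mul_le_mul_of_nonneg_left (le_wnorm (hbdd n) hz) (ha n)).trans hn.le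

lemma NullPow.nullTail {a : ℕ → ℝ} (ha : ∀ n, 0 ≤ a n) (h : NullPow β φ D a)
    (hφm : MapsTo φ unitDisk unitDisk) {W : ℝ → ℝ} {C : ℝ} (hC : 0 ≤ C)
    (hW : ∀ᶠ n : ℕ in atTop, ∀ r : ℝ, r < 1 → 1 < 2 * (n + 1) * (1 - r) → W r ≤ C * a n) :
    NullTail β φ D W := by
  intro ε hε
  obtain ⟨N, hN⟩ := eventually_atTop.1 (hW.and (h (ε / (2 * C + 1)) (by positivity)))
  refine ⟨1 - 1 / (2 * (N + 1)), by simp; positivity, fun z hz hs => ?_⟩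
  have hr := mem_unitDisk.1 (hφm hz)
  set r := ‖φ z‖ with hrdef
  have hpos : 0 < 1 - r := sub_pos.2 hr
  set n := ⌊1 / (2 * (1 - r))⌋₊ with hn
  have hn1 : (n : ℝ) ≤ 1 / (2 * (1 - r)) := Nat.floor_le (by positivity)
  have hn2 : 1 / (2 * (1 - r)) < n + 1 := Nat.lt_floor_add_one _
  rw [le_div_iff₀ (by positivity)] at hn1
  rw [div_lt_iff₀ (by positivity)] at hn2
  have hNn : N ≤ n := by
    refine Nat.le_floor ?_
    rw [le_div_iff₀ (by positivity)]
    have h1 : 1 - r < 1 / (2 * ((N : ℝ) + 1)) := by linarith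
    rw [lt_div_iff₀ (by positivity)] at h1
    nlinarith
  obtain ⟨h1, h2⟩ := hN n hNn
  have h1 := h1 r hr (by linarith)
  have h2 := h2 z hz
  have hpow : 1 / 2 ≤ r ^ n := by
    have := one_add_mul_le_pow (a := r - 1) (by linarith [norm_nonneg (φ z)]) n
    rw [add_sub_cancel] at this
    linarith
  have hv : 0 ≤ (1 - ‖z‖ ^ 2) ^ β * ‖D z‖ := mul_nonneg (weight_nonneg β hz) (norm_nonneg _)
  set V := (1 - ‖z‖ ^ 2) ^ β * ‖D z‖
  calc V * W r ≤ V * (C * a n) := mul_le_mul_of_nonneg_left h1 hv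
    _ = 2 * C * (a n * (V * (1 / 2))) := by ring
    _ ≤ 2 * C * (a n * (V * r ^ n)) := by
      have := ha n
      gcongr
    _ ≤ 2 * C * (ε / (2 * C + 1)) := by gcongr
    _ ≤ ε := by
      rw [mul_div_assoc', div_le_iff₀ (by positivity)]
      nlinarith

lemma NullTail.exists_norm_mul_le {W : ℝ → ℝ} (h : NullTail β φ D W)
    (hφm : MapsTo φ unitDisk unitDisk)
    (hD : ∃ M, ∀ z ∈ unitDisk, (1 - ‖z‖ ^ 2) ^ β * ‖D z‖ ≤ M) {ε K : ℝ} (hε : 0 < ε)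
    (hK : 0 ≤ K) :
    ∃ s < 1, ∃ δ > 0, ∀ F : ℂ → ℂ, (∀ w ∈ unitDisk, ‖F w‖ ≤ K * W ‖w‖) →
      (∀ w, ‖w‖ ≤ s → ‖F w‖ ≤ δ) →
      ∀ z ∈ unitDisk, (1 - ‖z‖ ^ 2) ^ β * ‖D z * F (φ z)‖ ≤ ε := by
  obtain ⟨M, hM⟩ := hD
  have hM0 : 0 ≤ M := (mul_nonneg (weight_nonneg β zero_mem_unitDisk) (norm_nonneg _)).trans
    (hM 0 zero_mem_unitDisk)
  obtain ⟨s, hs, hsmall⟩ := h (ε / (K + 1)) (by positivity)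
  refine ⟨s, hs, ε / (M + 1), by positivity, fun F hF hFs z hz => ?_⟩
  have hv : 0 ≤ (1 - ‖z‖ ^ 2) ^ β * ‖D z‖ := mul_nonneg (weight_nonneg β hz) (norm_nonneg _)
  rw [norm_mul, ← mul_assoc]
  rcases le_or_gt ‖φ z‖ s with hle | hlt
  · calc _ ≤ M * (ε / (M + 1)) := mul_le_mul (hM z hz) (hFs _ hle) (norm_nonneg _) hM0
      _ ≤ ε := by
        rw [mul_div_assoc', div_le_iff₀ (by positivity)]
        nlinarith
  · calc _ ≤ (1 - ‖z‖ ^ 2) ^ β * ‖D z‖ * (K * W ‖φ z‖) :=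
          mul_le_mul_of_nonneg_left (hF _ (hφm hz)) hv
      _ = K * ((1 - ‖z‖ ^ 2) ^ β * ‖D z‖ * W ‖φ z‖) := by ring
      _ ≤ K * (ε / (K + 1)) := mul_le_mul_of_nonneg_left (hsmall z hz hlt) hK
      _ ≤ ε := by
        rw [mul_div_assoc', div_le_iff₀ (by positivity)]
        nlinarith

lemma NullPow.nullTail_log (hφm : MapsTo φ unitDisk unitDisk)
    (h : NullPow β φ D fun n => Real.log n) :
    NullTail β φ D fun r => 1 - Real.log (1 - r) := by
  refine h.nullTail (fun n => Real.log_natCast_nonneg n) hφm (C := 4) (by norm_num) ?_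
  filter_upwards [eventually_ge_atTop 3] with n hn r hr hnr
  have hn3 : (3 : ℝ) ≤ n := by exact_mod_cast hn
  have h1 : 1 ≤ Real.log n := by
    rw [Real.le_log_iff_exp_le (by linarith)]
    exact Real.exp_one_lt_d9.le.trans (by linarith)
  have h2 : 0 < Real.log (2 * (n + 1) * (1 - r)) := Real.log_pos hnr
  rw [Real.log_mul (by positivity) (sub_pos.2 hr).ne'] at h2
  have h3 : Real.log (2 * (n + 1)) ≤ Real.log (n ^ 3 : ℝ) :=
    Real.log_le_log (by positivity) (by nlinarith [mul_self_nonneg ((n : ℝ) - 3)])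
  rw [Real.log_pow] at h3
  push_cast at h3
  linarith

lemma inv_one_sub_lt {n : ℕ} {r : ℝ} (hr : r < 1) (h : 1 < 2 * (n + 1) * (1 - r)) :
    (1 - r)⁻¹ < 2 * (n + 1) := by
  rw [inv_lt_iff_one_lt_mul₀ (sub_pos.2 hr)]
  linarith

lemma NullPow.nullTail_inv (hφm : MapsTo φ unitDisk unitDisk)
    (h : NullPow β φ D fun n => (n : ℝ) + 1) :
    NullTail β φ D fun r => (1 - r)⁻¹ :=
  h.nullTail (fun n => by positivity) hφm (C := 2) (by norm_num)
    (Eventually.of_forall fun _ _ hr hnr => (inv_one_sub_lt hr hnr).le)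

lemma NullPow.nullTail_inv_sq (hφm : MapsTo φ unitDisk unitDisk)
    (h : NullPow β φ D fun n => ((n : ℝ) + 1) ^ 2) :
    NullTail β φ D fun r => ((1 - r) ^ 2)⁻¹ := by
  refine h.nullTail (fun n => by positivity) hφm (C := 4) (by norm_num)
    (Eventually.of_forall fun n r hr hnr => ?_)
  have := pow_le_pow_left₀ (inv_nonneg.2 (sub_pos.2 hr).le) (inv_one_sub_lt hr hnr).le 2
  rw [inv_pow] at this
  linarith

end Tails

/-- The Bloch ball is totally bounded for uniform convergence on smaller closed disks. -/
lemma exists_finite_bloch_net (R : ℝ) {s δ : ℝ} (hs : s < 1) (hδ : 0 < δ) :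
    ∃ t : Finset (ℂ → ℂ), (∀ g ∈ t, BlochBound R g) ∧
      ∀ f, BlochBound R f → ∃ g ∈ t, ∀ w, ‖w‖ ≤ s → ‖f w - g w‖ ≤ δ := by
  classical
  set X := Metric.closedBall (0 : ℂ) s
  have hX : ∀ x : X, (x : ℂ) ∈ unitDisk := fun x =>
    mem_unitDisk.2 ((mem_closedBall_zero_iff.1 x.2).trans_lt hs)
  have : CompactSpace X := isCompact_iff_compactSpace.1 (isCompact_closedBall 0 s)
  set S : Set (BoundedContinuousFunction X ℂ) := {F | ∃ f, BlochBound R f ∧ ∀ x : X, F x = f x}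
  have hbound : ∀ {f}, BlochBound R f → ∀ x ∈ X, ‖deriv f x‖ ≤ R * (1 - s)⁻¹ :=
    fun {f} hf x hx => by
      have hx' : ‖x‖ ≤ s := mem_closedBall_zero_iff.1 hx
      refine (hf.norm_deriv_le (hX ⟨x, hx⟩)).trans (mul_le_mul_of_nonneg_left ?_ hf.nonneg)
      exact inv_anti₀ (sub_pos.2 hs) (by linarith)
  have hcomp : IsCompact (closure S) := by
    refine BoundedContinuousFunction.arzela_ascoli
      (Metric.closedBall 0 (R * (1 - Real.log (1 - s)))) (isCompact_closedBall _ _) S ?_ ?_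
    · rintro F x ⟨f, hf, hF⟩
      have hx' : ‖(x : ℂ)‖ ≤ s := mem_closedBall_zero_iff.1 x.2
      rw [mem_closedBall_zero_iff, hF]
      refine (hf.norm_le (hX x)).trans (mul_le_mul_of_nonneg_left ?_ hf.nonneg)
      have := Real.log_le_log (sub_pos.2 hs) (sub_le_sub_left hx' 1)
      linarith
    · refine Metric.equicontinuous_of_continuity_modulus (fun t => R * (1 - s)⁻¹ * t) ?_ _ ?_
      · exact Continuous.tendsto' (by fun_prop) _ _ (by simp)
      · rintro x y ⟨F, f, hf, hF⟩
        change dist (F x) (F y) ≤ _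
        rw [hF, hF, dist_eq_norm, Subtype.dist_eq, dist_eq_norm]
        exact (convex_closedBall (0 : ℂ) s).norm_image_sub_le_of_norm_deriv_le
          (fun z hz => hf.diff.differentiableAt (isOpen_unitDisk.mem_nhds (hX ⟨z, hz⟩)))
          (hbound hf) y.2 x.2
  obtain ⟨T, hTS, hTfin, hT⟩ := Metric.finite_approx_of_totallyBounded
    (hcomp.totallyBounded.subset subset_closure) δ hδ
  choose! G hG using fun F (hF : F ∈ S) => hF
  refine ⟨hTfin.toFinset.image G, fun g hg => ?_, fun f hf => ?_⟩
  · obtain ⟨F, hF, rfl⟩ := Finset.mem_image.1 hg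
    exact (hG F (hTS (hTfin.mem_toFinset.1 hF))).1
  · have hcont : Continuous fun x : X => f x := continuous_iff_continuousAt.2 fun x =>
      ((hf.diff.differentiableAt (isOpen_unitDisk.mem_nhds (hX x))).continuousAt).comp
        continuous_subtype_val.continuousAt
    set F₀ : BoundedContinuousFunction X ℂ := BoundedContinuousFunction.mkOfCompact ⟨_, hcont⟩
    obtain ⟨F, hF, hFF⟩ := mem_iUnion₂.1 (hT (show F₀ ∈ S from ⟨f, hf, fun x => rfl⟩))
    refine ⟨G F, Finset.mem_image_of_mem _ (hTfin.mem_toFinset.2 hF), fun w hw => ?_⟩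
    have h1 := (BoundedContinuousFunction.dist_coe_le_dist
      (f := F₀) (g := F) ⟨w, mem_closedBall_zero_iff.2 hw⟩).trans (Metric.mem_ball.1 hFF).le
    rw [(hG F (hTS hF)).2, dist_eq_norm] at h1
    exact h1

lemma blochBound_pow (n : ℕ) : BlochBound 1 fun w => w ^ n := by
  refine ⟨(differentiable_id.pow n).differentiableOn, ?_, fun w hw => ?_⟩
  · simpa using pow_le_one₀ (n := n) (norm_nonneg (0 : ℂ)) (by simp)
  · rw [mem_unitDisk] at hw
    rcases n with _ | m
    · simp
    · have h1 : ((m : ℝ) + 1) * ‖w‖ ^ m ≤ ∑ k ∈ Finset.range (m + 1), ‖w‖ ^ k := by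
        have := Finset.card_nsmul_le_sum (Finset.range (m + 1)) (fun k => ‖w‖ ^ k) (‖w‖ ^ m)
          fun k hk => pow_le_pow_of_le_one (norm_nonneg w) hw.le
            (Nat.lt_succ_iff.1 (Finset.mem_range.1 hk))
        simpa using this
      have h2 := mul_neg_geom_sum ‖w‖ (m + 1)
      have h3 : 0 ≤ ‖w‖ ^ (m + 1) := by positivity
      have h4 := mul_le_mul_of_nonneg_left h1 (sub_pos.2 hw).le
      have h5 : ‖deriv (fun w : ℂ => w ^ (m + 1)) w‖ = ((m : ℝ) + 1) * ‖w‖ ^ m := by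
        rw [deriv_pow_field, norm_mul, norm_pow, Complex.norm_natCast]
        simp
      rw [h5]
      linarith

section Operator

variable {β : ℝ} {u φ : ℂ → ℂ}

lemma sq_mul_deriv_deriv_wcomp_pow (hu : DifferentiableOn ℂ u unitDisk)
    (hφ : DifferentiableOn ℂ φ unitDisk) (hφm : MapsTo φ unitDisk unitDisk) (n : ℕ) {z : ℂ}
    (hz : z ∈ unitDisk) :
    φ z ^ 2 * deriv (deriv (wcomp u φ fun w => w ^ n)) z = deriv (deriv u) z * φ z ^ (n + 2)
      + n * coeffOne u φ z * φ z ^ (n + 1) + n * (n - 1) * coeffTwo u φ z * φ z ^ n := by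
  rw [deriv_deriv_wcomp hu hφ hφm (blochBound_pow n).diff hz]
  have h1 : deriv (fun w : ℂ => w ^ n) = fun w => (n : ℂ) * w ^ (n - 1) := by
    ext w
    simp
  rw [h1]
  rcases n with _ | _ | m
  · simp
    ring
  · simp
    ring
  · simp
    ring

lemma MemZygmund.exists_bound {f : ℂ → ℂ} (hf : MemZygmund β f) :
    ∃ M, ∀ z ∈ unitDisk, (1 - ‖z‖ ^ 2) ^ β * ‖deriv (deriv f) z‖ ≤ M := by
  obtain ⟨M, hM⟩ := hf.2
  exact ⟨M, fun z hz => hM (mem_image_of_mem _ hz)⟩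

lemma BoundedBlochToZygmund.exists_bound (h : BoundedBlochToZygmund 1 β u φ)
    (hu : DifferentiableOn ℂ u unitDisk) (hφ : DifferentiableOn ℂ φ unitDisk)
    (hφm : MapsTo φ unitDisk unitDisk) :
    (∃ M, ∀ z ∈ unitDisk, (1 - ‖z‖ ^ 2) ^ β * ‖deriv (deriv u) z‖ ≤ M) ∧
    (∃ M, ∀ z ∈ unitDisk, (1 - ‖z‖ ^ 2) ^ β * ‖coeffOne u φ z‖ ≤ M) ∧
    (∃ M, ∀ z ∈ unitDisk, (1 - ‖z‖ ^ 2) ^ β * ‖coeffTwo u φ z‖ ≤ M) := by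
  have hpow := fun n => (h.1 _ (blochBound_pow n).memBloch).exists_bound
  obtain ⟨M₀, h₀⟩ := hpow 0
  obtain ⟨M₁, h₁⟩ := hpow 1
  obtain ⟨M₂, h₂⟩ := hpow 2
  have hA : ∀ z ∈ unitDisk, (1 - ‖z‖ ^ 2) ^ β * ‖deriv (deriv u) z‖ ≤ M₀ := fun z hz => by
    have h1 : wcomp u φ (fun w => w ^ 0) = u := by
      ext w
      simp [wcomp]
    simpa only [h1] using h₀ z hz
  have hB : ∀ z ∈ unitDisk, (1 - ‖z‖ ^ 2) ^ β * ‖coeffOne u φ z‖ ≤ M₁ + M₀ := fun z hz => by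
    have hform := deriv_deriv_wcomp hu hφ hφm (blochBound_pow 1).diff hz
    have hφz := (mem_unitDisk.1 (hφm hz)).le
    have hle : ‖coeffOne u φ z‖ ≤ ‖deriv (deriv (wcomp u φ fun w => w ^ 1)) z‖
        + ‖deriv (deriv u) z‖ := by
      have : coeffOne u φ z = deriv (deriv (wcomp u φ fun w => w ^ 1)) z
          - deriv (deriv u) z * φ z := by
        rw [hform]
        simp
      rw [this]
      refine (norm_sub_le _ _).trans ?_
      gcongr
      rw [norm_mul]
      exact mul_le_of_le_one_right (norm_nonneg _) hφz
    have := mul_le_mul_of_nonneg_left hle (weight_nonneg β hz)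
    linarith [h₁ z hz, hA z hz]
  refine ⟨⟨_, hA⟩, ⟨_, hB⟩, ⟨M₂ + M₀ + 2 * (M₁ + M₀), fun z hz => ?_⟩⟩
  have hform := deriv_deriv_wcomp hu hφ hφm (blochBound_pow 2).diff hz
  have hφz := (mem_unitDisk.1 (hφm hz)).le
  have hle : 2 * ‖coeffTwo u φ z‖ ≤ ‖deriv (deriv (wcomp u φ fun w => w ^ 2)) z‖
      + ‖deriv (deriv u) z‖ + 2 * ‖coeffOne u φ z‖ := by
    have : 2 * coeffTwo u φ z = deriv (deriv (wcomp u φ fun w => w ^ 2)) z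
        - deriv (deriv u) z * φ z ^ 2 - 2 * (coeffOne u φ z * φ z) := by
      rw [hform]
      have h1 : deriv (fun w : ℂ => w ^ 2) = fun w => 2 * w := by
        ext w
        simp
      rw [h1]
      simp
      ring
    have h2 : 2 * ‖coeffTwo u φ z‖ = ‖2 * coeffTwo u φ z‖ := by simp
    rw [h2, this]
    refine (norm_sub_le _ _).trans (add_le_add ((norm_sub_le _ _).trans ?_) ?_)
    · gcongr
      rw [norm_mul, norm_pow]
      exact mul_le_of_le_one_right (norm_nonneg _) (pow_le_one₀ (norm_nonneg _) hφz)
    · rw [norm_mul, norm_mul, Complex.norm_two]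
      gcongr
      exact mul_le_of_le_one_right (norm_nonneg _) hφz
  have := mul_le_mul_of_nonneg_left hle (weight_nonneg β hz)
  have h3 : 0 ≤ (1 - ‖z‖ ^ 2) ^ β * ‖coeffTwo u φ z‖ :=
    mul_nonneg (weight_nonneg β hz) (norm_nonneg _)
  linarith [h₂ z hz, hA z hz, hB z hz]

lemma compact_of_nullTail (h : BoundedBlochToZygmund 1 β u φ)
    (hu : DifferentiableOn ℂ u unitDisk) (hφ : DifferentiableOn ℂ φ unitDisk)
    (hφm : MapsTo φ unitDisk unitDisk)
    (hA : NullTail β φ (deriv (deriv u)) fun r => 1 - Real.log (1 - r))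
    (hB : NullTail β φ (coeffOne u φ) fun r => (1 - r)⁻¹)
    (hC : NullTail β φ (coeffTwo u φ) fun r => ((1 - r) ^ 2)⁻¹) :
    CompactBlochToZygmund 1 β u φ := by
  classical
  refine ⟨h, fun R ε hε => ?_⟩
  obtain ⟨bA, bB, bC⟩ := h.exists_bound hu hφ hφm
  rcases lt_or_ge R 0 with hR | hR
  · refine ⟨∅, by simp, fun f hf hfR => ?_⟩
    exact absurd (hf.blochBound hfR).nonneg (not_le.2 hR)
  obtain ⟨s₀, hs₀, δ₀, hδ₀, H₀⟩ := hA.exists_norm_mul_le hφm bA (ε := ε / 6) (K := R + R)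
    (by positivity) (by positivity)
  obtain ⟨s₁, hs₁, δ₁, hδ₁, H₁⟩ := hB.exists_norm_mul_le hφm bB (ε := ε / 6) (K := R + R)
    (by positivity) (by positivity)
  obtain ⟨s₂, hs₂, δ₂, hδ₂, H₂⟩ := hC.exists_norm_mul_le hφm bC (ε := ε / 6)
    (K := 4 * (R + R)) (by positivity) (by positivity)
  have hφ0 := mem_unitDisk.1 (hφm zero_mem_unitDisk)
  set s := max (max s₀ s₁) (max s₂ ‖φ 0‖) with hsdef
  have hs : s < 1 := max_lt (max_lt hs₀ hs₁) (max_lt hs₂ hφ0)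
  set L := ‖u 0‖ + ‖deriv u 0‖ + ‖u 0‖ * ‖deriv φ 0‖ + 1 with hL
  have hLpos : 0 < L := by positivity
  set δ := min (min δ₀ δ₁) (min δ₂ (ε / (6 * L))) with hδdef
  have hδ : 0 < δ := by
    refine lt_min (lt_min hδ₀ hδ₁) (lt_min hδ₂ ?_)
    positivity
  set d := (1 - s) / 3 with hd
  have hdpos : 0 < d := by simp only [hd]; linarith
  set η := min δ (min (δ * d) (δ * d * d)) with hηdef
  have hη : 0 < η := lt_min hδ (lt_min (by positivity) (by positivity))
  obtain ⟨t, ht, htnet⟩ := exists_finite_bloch_net R (s := s + 2 * d) (δ := η)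
    (by simp only [hd]; linarith) hη
  refine ⟨t.image (wcomp u φ), fun g hg => ?_, fun f hf hfR => ?_⟩
  · obtain ⟨g', hg', rfl⟩ := Finset.mem_image.1 hg
    exact h.1 g' (ht g' hg').memBloch
  obtain ⟨g, hg, hfg⟩ := htnet f (hf.blochBound hfR)
  refine ⟨_, Finset.mem_image_of_mem _ hg, ?_⟩
  have hF : BlochBound (R + R) fun w => f w - g w := (hf.blochBound hfR).sub (ht g hg)
  have heq : (fun z => wcomp u φ f z - wcomp u φ g z) = wcomp u φ fun w => f w - g w := by
    ext z
    simp [wcomp, mul_sub]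
  rw [heq]
  replace hfg : ∀ w, ‖w‖ ≤ s + 2 * d → ‖(fun w => f w - g w) w‖ ≤ η := hfg
  generalize (fun w => f w - g w) = F at hF hfg ⊢
  have hF1 := norm_deriv_le_of_closedBall hF.diff (s := s + d) (ρ := s + 2 * d)
    (by linarith) (by simp only [hd]; linarith) hfg
  have hF2 := norm_deriv_le_of_closedBall (hF.diff.deriv isOpen_unitDisk) (s := s)
    (ρ := s + d) (by linarith) (by simp only [hd]; linarith) hF1
  have e1 : s + 2 * d - (s + d) = d := by ring
  have e2 : s + d - s = d := by ring
  rw [e1] at hF1 hF2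
  rw [e2] at hF2
  have b0 : ∀ w, ‖w‖ ≤ s → ‖F w‖ ≤ δ := fun w hw =>
    (hfg w (by linarith)).trans (min_le_left _ _)
  have b1 : ∀ w, ‖w‖ ≤ s → ‖deriv F w‖ ≤ δ := fun w hw => by
    refine (hF1 w (by linarith)).trans ?_
    rw [div_le_iff₀ hdpos]
    exact (min_le_right _ _).trans (min_le_left _ _)
  have b2 : ∀ w, ‖w‖ ≤ s → ‖deriv (deriv F) w‖ ≤ δ := fun w hw => by
    refine (hF2 w hw).trans ?_
    rw [div_div, div_le_iff₀ (by positivity), ← mul_assoc]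
    exact (min_le_right _ _).trans (min_le_right _ _)
  have hs0 : s₀ ≤ s := (le_max_left _ _).trans (le_max_left _ _)
  have hs1 : s₁ ≤ s := (le_max_right _ _).trans (le_max_left _ _)
  have hs2 : s₂ ≤ s := (le_max_left _ _).trans (le_max_right _ _)
  have hsφ : ‖φ 0‖ ≤ s := (le_max_right _ _).trans (le_max_right _ _)
  have hδ0 : δ ≤ δ₀ := (min_le_left _ _).trans (min_le_left _ _)
  have hδ1 : δ ≤ δ₁ := (min_le_left _ _).trans (min_le_right _ _)
  have hδ2 : δ ≤ δ₂ := (min_le_right _ _).trans (min_le_left _ _)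
  have hδL : δ * (6 * L) ≤ ε := by
    rw [← le_div_iff₀ (by positivity)]
    exact (min_le_right _ _).trans (min_le_right _ _)
  have hw : wnorm β (deriv (deriv (wcomp u φ F))) ≤ ε / 2 := by
    refine wnorm_le fun z hz => ?_
    rw [deriv_deriv_wcomp hu hφ hφm hF.diff hz]
    have i0 := H₀ F (fun w hw => hF.norm_le hw) (fun w hw => (b0 w (hw.trans hs0)).trans hδ0) z hz
    have i1 := H₁ (deriv F) (fun w hw => hF.norm_deriv_le hw)
      (fun w hw => (b1 w (hw.trans hs1)).trans hδ1) z hz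
    have i2 := H₂ (deriv (deriv F)) (fun w hw => hF.norm_deriv_deriv_le hw)
      (fun w hw => (b2 w (hw.trans hs2)).trans hδ2) z hz
    have := mul_le_mul_of_nonneg_left (norm_add₃_le (a := deriv (deriv u) z * F (φ z))
      (b := coeffOne u φ z * deriv F (φ z)) (c := coeffTwo u φ z * deriv (deriv F) (φ z)))
      (weight_nonneg β hz)
    linarith
  have hv0 : ‖wcomp u φ F 0‖ ≤ ‖u 0‖ * δ := by
    rw [wcomp, norm_mul]
    exact mul_le_mul_of_nonneg_left (b0 _ hsφ) (norm_nonneg _)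
  have hv1 : ‖deriv (wcomp u φ F) 0‖ ≤ ‖deriv u 0‖ * δ + ‖u 0‖ * ‖deriv φ 0‖ * δ := by
    rw [deriv_wcomp hu hφ hφm hF.diff zero_mem_unitDisk]
    refine (norm_add_le _ _).trans (add_le_add ?_ ?_)
    · rw [norm_mul]
      exact mul_le_mul_of_nonneg_left (b0 _ hsφ) (norm_nonneg _)
    · rw [norm_mul, norm_mul, mul_assoc, mul_comm ‖deriv φ 0‖]
      gcongr
      exact b1 _ hsφ
  have hsum : ‖u 0‖ * δ + (‖deriv u 0‖ * δ + ‖u 0‖ * ‖deriv φ 0‖ * δ) ≤ δ * L := by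
    simp only [hL]
    linarith
  unfold zygNorm
  linarith

/-- `f i → 0` along `l`, uniformly on closed disks of radius less than one. -/
def LocallySmall {ι : Type*} (l : Filter ι) (f : ι → ℂ → ℂ) : Prop :=
  ∀ s < 1, ∀ δ > 0, ∀ᶠ i in l, ∀ w, ‖w‖ ≤ s → ‖f i w‖ ≤ δ

lemma LocallySmall.deriv {ι : Type*} {l : Filter ι} {f : ι → ℂ → ℂ} (h : LocallySmall l f)
    (hf : ∀ i, DifferentiableOn ℂ (f i) unitDisk) : LocallySmall l fun i => deriv (f i) := by
  intro s hs δ hδ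
  filter_upwards [h ((1 + s) / 2) (by linarith) (δ * ((1 - s) / 2))
    (mul_pos hδ (by linarith))] with i hi w hw
  refine (norm_deriv_le_of_closedBall (hf i) (by linarith) (by linarith) hi w hw).trans_eq ?_
  rw [div_eq_iff (by linarith)]
  ring

lemma LocallySmall.tendsto {ι : Type*} {l : Filter ι} {f : ι → ℂ → ℂ} (h : LocallySmall l f)
    {w : ℂ} (hw : w ∈ unitDisk) : Tendsto (fun i => f i w) l (nhds 0) := by
  rw [Metric.tendsto_nhds]
  intro ε hε
  filter_upwards [h ‖w‖ (mem_unitDisk.1 hw) (ε / 2) (half_pos hε)] with i hi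
  rw [dist_zero_right]
  exact (hi w le_rfl).trans_lt (half_lt_self hε)

lemma CompactBlochToZygmund.eventually_le (h : CompactBlochToZygmund 1 β u φ)
    (hu : DifferentiableOn ℂ u unitDisk) (hφ : DifferentiableOn ℂ φ unitDisk)
    (hφm : MapsTo φ unitDisk unitDisk) {ι : Type*} {l : Filter ι} {f : ι → ℂ → ℂ} {R : ℝ}
    (hf : ∀ i, BlochBound R (f i)) (hlim : LocallySmall l f) {ε : ℝ} (hε : 0 < ε) :
    ∀ᶠ i in l, ∀ z ∈ unitDisk,
      (1 - ‖z‖ ^ 2) ^ β * ‖deriv (deriv (wcomp u φ (f i))) z‖ ≤ ε := by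
  obtain ⟨T, hT, hnet⟩ := h.2 (3 * R) (ε / 4) (by positivity)
  have hpeak : ∀ g ∈ T, ∃ a ∈ unitDisk, ∀ z ∈ unitDisk, (1 - ‖z‖ ^ 2) ^ β *
      ‖deriv (deriv g) z‖ ≤ (1 - ‖a‖ ^ 2) ^ β * ‖deriv (deriv g) a‖ + ε / 4 := by
    intro g hg
    obtain ⟨_, ⟨a, ha, rfl⟩, hlt⟩ := exists_lt_of_lt_csSup
      (s := (fun z => (1 - ‖z‖ ^ 2) ^ β * ‖deriv (deriv g) z‖) '' unitDisk)
      ⟨_, mem_image_of_mem _ zero_mem_unitDisk⟩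
      (sub_lt_self (wnorm β (deriv (deriv g))) (show 0 < ε / 4 by positivity))
    refine ⟨a, ha, fun z hz => ?_⟩
    have := le_wnorm (hT g hg).2 hz
    simp only at hlt
    linarith
  choose! a ha hapeak using hpeak
  have hpt : ∀ g ∈ T, ∀ᶠ i in l, (1 - ‖a g‖ ^ 2) ^ β *
      ‖deriv (deriv (wcomp u φ (f i))) (a g)‖ ≤ ε / 4 := by
    intro g hg
    have hlim1 := hlim.deriv fun i => (hf i).diff
    have hlim2 := hlim1.deriv fun i => (hf i).diff.deriv isOpen_unitDisk
    have hmem := hφm (ha g hg)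
    have ht := ((((hlim.tendsto hmem).const_mul (deriv (deriv u) (a g))).add
      ((hlim1.tendsto hmem).const_mul (coeffOne u φ (a g)))).add
      ((hlim2.tendsto hmem).const_mul (coeffTwo u φ (a g)))).norm.const_mul
      ((1 - ‖a g‖ ^ 2) ^ β)
    simp only [mul_zero, add_zero, norm_zero] at ht
    filter_upwards [ht.eventually (gt_mem_nhds (show 0 < ε / 4 by positivity))] with i hi
    rw [deriv_deriv_wcomp hu hφ hφm (hf i).diff (ha g hg)]
    exact hi.le
  filter_upwards [(Filter.eventually_all_finset T).2 hpt] with i hi z hz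
  obtain ⟨g, hg, hle⟩ := hnet (f i) (hf i).memBloch (hf i).blochNorm_le
  have hfi := h.1.1 (f i) (hf i).memBloch
  have hda : ∀ {F : ℂ → ℂ} {w : ℂ}, DifferentiableOn ℂ F unitDisk → w ∈ unitDisk →
      DifferentiableAt ℂ F w := fun hF hw => hF.differentiableAt (isOpen_unitDisk.mem_nhds hw)
  have hsub : ∀ w ∈ unitDisk, deriv (deriv fun z => wcomp u φ (f i) z - g z) w =
      deriv (deriv (wcomp u φ (f i))) w - deriv (deriv g) w := fun w hw => by
    have hev : deriv (fun z => wcomp u φ (f i) z - g z) =ᶠ[nhds w]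
        fun z => deriv (wcomp u φ (f i)) z - deriv g z := by
      filter_upwards [isOpen_unitDisk.mem_nhds hw] with y hy
      exact deriv_fun_sub (hda hfi.1 hy) (hda (hT g hg).1 hy)
    rw [hev.deriv_eq]
    exact deriv_fun_sub (hda (hfi.1.deriv isOpen_unitDisk) hw)
      (hda ((hT g hg).1.deriv isOpen_unitDisk) hw)
  have hclose : ∀ w ∈ unitDisk, (1 - ‖w‖ ^ 2) ^ β *
      ‖deriv (deriv (wcomp u φ (f i))) w - deriv (deriv g) w‖ ≤ ε / 4 := fun w hw => by
    obtain ⟨M₁, h₁⟩ := hfi.exists_bound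
    obtain ⟨M₂, h₂⟩ := (hT g hg).exists_bound
    have hb : BddAbove ((fun z => (1 - ‖z‖ ^ 2) ^ β *
        ‖deriv (deriv fun z => wcomp u φ (f i) z - g z) z‖) '' unitDisk) := by
      refine ⟨M₁ + M₂, ?_⟩
      rintro _ ⟨y, hy, rfl⟩
      simp only [hsub y hy]
      have := mul_le_mul_of_nonneg_left (norm_sub_le (deriv (deriv (wcomp u φ (f i))) y)
        (deriv (deriv g) y)) (weight_nonneg β hy)
      linarith [h₁ y hy, h₂ y hy]
    have := le_wnorm hb hw
    rw [hsub w hw] at this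
    refine this.trans (le_trans ?_ hle)
    unfold zygNorm
    linarith [norm_nonneg ((fun z => wcomp u φ (f i) z - g z) 0),
      norm_nonneg (_root_.deriv (fun z => wcomp u φ (f i) z - g z) 0)]
  have k1 := hclose z hz
  have k2 := hclose _ (ha g hg)
  have k3 := hapeak g hg z hz
  have k4 := hi g hg
  have k5 := mul_le_mul_of_nonneg_left (norm_le_norm_add_norm_sub'
    (deriv (deriv (wcomp u φ (f i))) z) (deriv (deriv g) z)) (weight_nonneg β hz)
  have k6 := mul_le_mul_of_nonneg_left (norm_le_norm_add_norm_sub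
    (deriv (deriv (wcomp u φ (f i))) (a g)) (deriv (deriv g) (a g)))
    (weight_nonneg β (ha g hg))
  linarith

/-- Second differences of `k ↦ A p^(k+2) + k B p^(k+1) + k(k-1) C p^k` isolate `C` and `B`. -/
lemma norm_coeff_le_of_combination {A B C p : ℂ} {e : ℝ} (hp : ‖p‖ ≤ 1) {n : ℕ} (hn : 1 ≤ n)
    (hE : ∀ k, n ≤ k →
      ‖A * p ^ (k + 2) + k * B * p ^ (k + 1) + k * (k - 1) * C * p ^ k‖ ≤ e) :
    (n : ℝ) ^ 2 * (‖C‖ * ‖p‖ ^ (3 * n)) ≤ 2 * e ∧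
      (n : ℝ) * (‖B‖ * ‖p‖ ^ (3 * n + 1)) ≤ 10 * e := by
  set E : ℕ → ℂ := fun k =>
    A * p ^ (k + 2) + k * B * p ^ (k + 1) + k * (k - 1) * C * p ^ k with hEdef
  have hpE : ∀ j k : ℕ, n ≤ k → ‖p ^ j * E k‖ ≤ e := fun j k hk => by
    rw [norm_mul, norm_pow]
    exact (mul_le_of_le_one_left (norm_nonneg _) (pow_le_one₀ (norm_nonneg _) hp)).trans (hE k hk)
  have h1 := hpE 0 (3 * n) (by omega)
  have h2 := hpE n (2 * n) (by omega)
  have h3 := hpE (2 * n) n le_rfl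
  have hCid : 2 * ((n : ℂ) ^ 2 * (C * p ^ (3 * n))) =
      p ^ 0 * E (3 * n) - 2 * (p ^ n * E (2 * n)) + p ^ (2 * n) * E n := by
    simp only [hEdef]
    push_cast
    ring
  have hBid : (n : ℂ) * (B * p ^ (3 * n + 1)) = p ^ n * E (2 * n) - p ^ (2 * n) * E n
      - (3 * n ^ 2 - n) * (C * p ^ (3 * n)) := by
    simp only [hEdef]
    push_cast
    ring
  have hC : (n : ℝ) ^ 2 * (‖C‖ * ‖p‖ ^ (3 * n)) ≤ 2 * e := by
    have h4 := congrArg norm hCid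
    simp only [norm_mul, norm_pow, Complex.norm_natCast, Complex.norm_two] at h4
    have h5 := norm_add_le (p ^ 0 * E (3 * n) - 2 * (p ^ n * E (2 * n))) (p ^ (2 * n) * E n)
    have h6 := norm_sub_le (p ^ 0 * E (3 * n)) (2 * (p ^ n * E (2 * n)))
    rw [norm_mul 2, Complex.norm_two] at h6
    linarith
  refine ⟨hC, ?_⟩
  have h4 := congrArg norm hBid
  rw [norm_mul, norm_mul, norm_pow, Complex.norm_natCast] at h4
  have h5 := norm_sub_le (p ^ n * E (2 * n) - p ^ (2 * n) * E n)
    ((3 * n ^ 2 - n) * (C * p ^ (3 * n)))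
  have h6 := norm_sub_le (p ^ n * E (2 * n)) (p ^ (2 * n) * E n)
  have h7 : ‖(3 * n ^ 2 - n : ℂ)‖ ≤ 4 * (n : ℝ) ^ 2 := by
    refine (norm_sub_le _ _).trans ?_
    have hn' : (1 : ℝ) ≤ n := by exact_mod_cast hn
    simp only [norm_mul, norm_pow, Complex.norm_natCast, Complex.norm_ofNat]
    nlinarith
  have h8 : ‖(3 * n ^ 2 - n : ℂ) * (C * p ^ (3 * n))‖ ≤
      4 * ((n : ℝ) ^ 2 * (‖C‖ * ‖p‖ ^ (3 * n))) := by
    rw [norm_mul, norm_mul C, norm_pow, ← mul_assoc 4]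
    gcongr
  linarith

lemma CompactBlochToZygmund.nullPow_coeff (h : CompactBlochToZygmund 1 β u φ)
    (hu : DifferentiableOn ℂ u unitDisk) (hφ : DifferentiableOn ℂ φ unitDisk)
    (hφm : MapsTo φ unitDisk unitDisk) :
    NullPow β φ (coeffOne u φ) (fun n => (n : ℝ) + 1) ∧
      NullPow β φ (coeffTwo u φ) (fun n => ((n : ℝ) + 1) ^ 2) := by
  have hsmall : LocallySmall atTop fun (n : ℕ) (w : ℂ) => w ^ n := by
    intro s hs δ hδ
    have hs' : max s 0 < 1 := max_lt hs one_pos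
    filter_upwards [(tendsto_pow_atTop_nhds_zero_of_lt_one (le_max_right s 0) hs').eventually
      (gt_mem_nhds hδ)] with n hn w hw
    rw [norm_pow]
    exact (pow_le_pow_left₀ (norm_nonneg w) (hw.trans (le_max_left _ _)) n).trans hn.le
  have key : ∀ ε > 0, ∀ᶠ m : ℕ in atTop, ∀ z ∈ unitDisk,
      ((m : ℝ) + 1) * ((1 - ‖z‖ ^ 2) ^ β * ‖coeffOne u φ z‖ * ‖φ z‖ ^ m) ≤ ε ∧
      ((m : ℝ) + 1) ^ 2 * ((1 - ‖z‖ ^ 2) ^ β * ‖coeffTwo u φ z‖ * ‖φ z‖ ^ m) ≤ ε := by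
    intro ε hε
    obtain ⟨N, hN⟩ := eventually_atTop.1
      (h.eventually_le hu hφ hφm blochBound_pow hsmall (ε := ε / 128) (by positivity))
    filter_upwards [eventually_ge_atTop (4 * (N + 1))] with m hm z hz
    obtain ⟨n, hn⟩ : ∃ n, n = m / 4 := ⟨_, rfl⟩
    have hn1 : 1 ≤ n := by omega
    have hnm : 3 * n + 1 ≤ m := by omega
    have hm8 : (m : ℝ) + 1 ≤ 8 * n := by
      have : m + 1 ≤ 8 * n := by omega
      exact_mod_cast this
    have hp := (mem_unitDisk.1 (hφm hz)).le
    have hv : 0 < (1 - ‖z‖ ^ 2) ^ β := by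
      have := mem_unitDisk.1 hz
      exact Real.rpow_pos_of_pos (by nlinarith [norm_nonneg z]) _
    set V := (1 - ‖z‖ ^ 2) ^ β
    obtain ⟨hC, hB⟩ := norm_coeff_le_of_combination (A := deriv (deriv u) z)
      (B := coeffOne u φ z) (C := coeffTwo u φ z) (p := φ z) (e := ε / 128 / V) hp hn1
      (fun k hk => by
        rw [← sq_mul_deriv_deriv_wcomp_pow hu hφ hφm k hz, le_div_iff₀ hv, norm_mul, norm_pow,
          mul_comm]
        refine le_trans ?_ (hN k (by omega) z hz)
        exact mul_le_mul_of_nonneg_left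
          (mul_le_of_le_one_left (norm_nonneg _) (pow_le_one₀ (norm_nonneg _) hp)) hv.le)
    rw [mul_div_assoc', le_div_iff₀ hv] at hC hB
    have hpow1 := pow_le_pow_of_le_one (norm_nonneg (φ z)) hp hnm
    have hpow2 := pow_le_pow_of_le_one (norm_nonneg (φ z)) hp (show 3 * n ≤ m by omega)
    constructor
    · calc _ ≤ (8 * n : ℝ) * (V * ‖coeffOne u φ z‖ * ‖φ z‖ ^ (3 * n + 1)) := by gcongr
        _ ≤ ε := by linarith
    · calc _ ≤ (8 * n : ℝ) ^ 2 * (V * ‖coeffTwo u φ z‖ * ‖φ z‖ ^ (3 * n)) := by gcongr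
        _ ≤ ε := by linarith
  exact ⟨fun ε hε => (key ε hε).mono fun m hm z hz => (hm z hz).1,
    fun ε hε => (key ε hε).mono fun m hm z hz => (hm z hz).2⟩

end Operator

/-- A block of the Taylor series of `-log (1 - c w)`. -/
def logBlock (n : ℕ) (c w : ℂ) : ℂ :=
  ∑ k ∈ Finset.Ico n (n ^ 2), (c * w) ^ (k + 1) / (k + 1)

lemma hasDerivAt_logBlock (n : ℕ) (c w : ℂ) :
    HasDerivAt (logBlock n c) (∑ k ∈ Finset.Ico n (n ^ 2), c * (c * w) ^ k) w := by
  refine HasDerivAt.fun_sum fun k _ => ?_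
  have h1 : HasDerivAt (fun w => c * w) c w := by
    simpa using (hasDerivAt_id w).const_mul c
  refine ((h1.fun_pow (k + 1)).div_const ((k : ℂ) + 1)).congr_deriv ?_
  have : (k : ℂ) + 1 ≠ 0 := Nat.cast_add_one_ne_zero k
  rw [Nat.add_sub_cancel]
  push_cast
  field_simp

lemma norm_logBlock_le {n : ℕ} {c w : ℂ} (hc : ‖c‖ = 1) (hw : ‖w‖ < 1) :
    ‖logBlock n c w‖ ≤ ‖w‖ ^ n / (1 - ‖w‖) := by
  refine (norm_sum_le_of_le (f := fun k : ℕ => (c * w) ^ (k + 1) / ((k : ℂ) + 1))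
    (n := fun k => ‖w‖ ^ k) _ fun k _ => ?_).trans
    (geom_sum_Ico_le_of_lt_one (norm_nonneg w) hw)
  have hk : ‖(k : ℂ) + 1‖ = k + 1 := by
    have := Complex.norm_natCast (k + 1)
    push_cast at this
    exact this
  rw [norm_div, norm_pow, norm_mul, hc, one_mul, hk, div_le_iff₀ (by positivity), pow_succ]
  gcongr
  linarith [(Nat.cast_nonneg k : (0 : ℝ) ≤ k)]

lemma blochBound_logBlock (n : ℕ) {c : ℂ} (hc : ‖c‖ = 1) : BlochBound 1 (logBlock n c) := by
  refine ⟨fun w _ => (hasDerivAt_logBlock n c w).differentiableAt.differentiableWithinAt,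
    by simp [logBlock], fun w hw => ?_⟩
  rw [mem_unitDisk] at hw
  rw [(hasDerivAt_logBlock n c w).deriv, ← le_div_iff₀ (sub_pos.2 hw)]
  refine (norm_sum_le_of_le (n := fun k => ‖w‖ ^ k) _ fun k _ => ?_).trans
    ((geom_sum_Ico_le_of_lt_one (norm_nonneg w) hw).trans ?_)
  · simp [hc]
  · have := sub_pos.2 hw
    gcongr
    exact pow_le_one₀ (norm_nonneg _) hw.le

lemma locallySmall_logBlock :
    LocallySmall (comap Prod.fst atTop)
      fun i : ℕ × {c : ℂ // ‖c‖ = 1} => logBlock i.1 (i.2 : ℂ) := by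
  intro s hs δ hδ
  have hs' : max s 0 < 1 := max_lt hs one_pos
  have hlim := (tendsto_pow_atTop_nhds_zero_of_lt_one (le_max_right s 0) hs').div_const
    (1 - max s 0)
  rw [zero_div] at hlim
  rw [eventually_comap]
  filter_upwards [hlim.eventually (gt_mem_nhds hδ)] with n hn
  rintro ⟨_, c, hc⟩ rfl w hw
  have hw' := hw.trans (le_max_left s 0)
  refine (norm_logBlock_le hc (hw.trans_lt hs)).trans (le_trans ?_ hn.le)
  have := sub_pos.2 hs'
  gcongr

lemma log_sub_log_le_sum {m N : ℕ} (h : m ≤ N) :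
    Real.log (N + 1) - Real.log (m + 1) ≤ ∑ k ∈ Finset.Ico m N, 1 / ((k : ℝ) + 1) := by
  induction N, h using Nat.le_induction with
  | base => simp
  | succ N hN ih =>
    rw [Finset.sum_Ico_succ_top hN]
    have h1 := Real.log_le_sub_one_of_pos
      (show (0 : ℝ) < ((N : ℝ) + 1 + 1) / (N + 1) by positivity)
    rw [Real.log_div (by positivity) (by positivity)] at h1
    have h2 : ((N : ℝ) + 1 + 1) / (N + 1) - 1 = 1 / (N + 1) := by
      field_simp
      ring
    push_cast
    linarith

lemma two_mul_log_succ_le {n : ℕ} (hn : 3 ≤ n) :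
    2 * Real.log (n + 1) ≤ 3 * Real.log n := by
  have hn' : (3 : ℝ) ≤ n := by exact_mod_cast hn
  have h1 : Real.log (((n : ℝ) + 1) ^ 2) ≤ Real.log ((n : ℝ) ^ 3) :=
    Real.log_le_log (by positivity) (by nlinarith [mul_self_nonneg ((n : ℝ) - 3)])
  rw [Real.log_pow, Real.log_pow] at h1
  exact_mod_cast h1

/-- Along the ray on which its terms align, `logBlock n` has logarithmic size. -/
lemma exists_log_mul_pow_le_norm_logBlock {n : ℕ} (hn : 3 ≤ n) {w : ℂ} (hw : ‖w‖ ≤ 1) :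
    ∃ c : ℂ, ‖c‖ = 1 ∧ Real.log n * ‖w‖ ^ (n ^ 2) ≤ 2 * ‖logBlock n c w‖ := by
  obtain ⟨c, hc, hcw⟩ : ∃ c : ℂ, ‖c‖ = 1 ∧ c * w = (‖w‖ : ℂ) := by
    rcases eq_or_ne w 0 with rfl | h0
    · exact ⟨1, by simp, by simp⟩
    · have hne : (‖w‖ : ℂ) ≠ 0 := by simpa using h0
      exact ⟨‖w‖ / w, by simp [h0], by field_simp⟩
  refine ⟨c, hc, ?_⟩
  have hval : logBlock n c w =
      ((∑ k ∈ Finset.Ico n (n ^ 2), ‖w‖ ^ (k + 1) / ((k : ℝ) + 1) : ℝ) : ℂ) := by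
    simp only [logBlock, hcw]
    push_cast
    rfl
  have hle : ‖w‖ ^ (n ^ 2) * ∑ k ∈ Finset.Ico n (n ^ 2), 1 / ((k : ℝ) + 1) ≤
      ∑ k ∈ Finset.Ico n (n ^ 2), ‖w‖ ^ (k + 1) / ((k : ℝ) + 1) := by
    rw [Finset.mul_sum]
    refine Finset.sum_le_sum fun k hk => ?_
    rw [mul_one_div]
    have := pow_le_pow_of_le_one (norm_nonneg w) hw (Nat.succ_le_of_lt (Finset.mem_Ico.1 hk).2)
    gcongr
  have hlog := log_sub_log_le_sum (show n ≤ n ^ 2 by nlinarith)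
  have hn' : (3 : ℝ) ≤ n := by exact_mod_cast hn
  have h1 : 2 * Real.log n ≤ Real.log (((n ^ 2 : ℕ) : ℝ) + 1) := by
    have : Real.log ((n : ℝ) ^ 2) ≤ Real.log (((n ^ 2 : ℕ) : ℝ) + 1) :=
      Real.log_le_log (by positivity) (by push_cast; linarith)
    rw [Real.log_pow] at this
    exact_mod_cast this
  have h2 := two_mul_log_succ_le hn
  have h3 : Real.log n ≤ 2 * ∑ k ∈ Finset.Ico n (n ^ 2), 1 / ((k : ℝ) + 1) := by linarith
  have h4 := mul_le_mul_of_nonneg_right h3 (pow_nonneg (norm_nonneg w) (n ^ 2))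
  rw [hval, Complex.norm_real]
  have := Real.le_norm_self (∑ k ∈ Finset.Ico n (n ^ 2), ‖w‖ ^ (k + 1) / ((k : ℝ) + 1))
  linarith

lemma CompactBlochToZygmund.nullPow_log {β : ℝ} {u φ : ℂ → ℂ}
    (h : CompactBlochToZygmund 1 β u φ)
    (hu : DifferentiableOn ℂ u unitDisk) (hφ : DifferentiableOn ℂ φ unitDisk)
    (hφm : MapsTo φ unitDisk unitDisk) :
    NullPow β φ (deriv (deriv u)) fun n => Real.log n := by
  intro ε hε
  obtain ⟨-, bB, bC⟩ := h.1.exists_bound hu hφ hφm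
  obtain ⟨nB, nC⟩ := h.nullPow_coeff hu hφ hφm
  obtain ⟨s₁, hs₁, δ₁, hδ₁, H₁⟩ := (nB.nullTail_inv hφm).exists_norm_mul_le hφm bB
    (ε := ε / 18) (K := 1) (by positivity) (by positivity)
  obtain ⟨s₂, hs₂, δ₂, hδ₂, H₂⟩ := (nC.nullTail_inv_sq hφm).exists_norm_mul_le hφm bC
    (ε := ε / 18) (K := 4 * 1) (by positivity) (by positivity)
  have hbloch : ∀ i : ℕ × {c : ℂ // ‖c‖ = 1}, BlochBound 1 (logBlock i.1 (i.2 : ℂ)) :=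
    fun i => blochBound_logBlock i.1 i.2.2
  have hsmall1 := locallySmall_logBlock.deriv fun i => (hbloch i).diff
  have hsmall2 := hsmall1.deriv fun i => (hbloch i).diff.deriv isOpen_unitDisk
  have hev := ((h.eventually_le hu hφ hφm hbloch locallySmall_logBlock (ε := ε / 18)
    (by positivity)).and (hsmall1 s₁ hs₁ δ₁ hδ₁)).and (hsmall2 s₂ hs₂ δ₂ hδ₂)
  obtain ⟨N, hN⟩ := eventually_atTop.1 (eventually_comap.1 hev)
  filter_upwards [eventually_ge_atTop ((N + 3) ^ 2)] with m hm z hz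
  obtain ⟨n, hn⟩ : ∃ n, n = Nat.sqrt m := ⟨_, rfl⟩
  have hNn : N + 3 ≤ n := by
    rw [hn, Nat.le_sqrt']
    exact hm
  have hnm : n ^ 2 ≤ m := hn ▸ Nat.sqrt_le' m
  have hmn : m < (n + 1) ^ 2 := hn ▸ Nat.lt_succ_sqrt' m
  have hp := (mem_unitDisk.1 (hφm hz)).le
  obtain ⟨c, hc, hlow⟩ := exists_log_mul_pow_le_norm_logBlock (n := n) (by omega) hp
  obtain ⟨⟨h0, h1⟩, h2⟩ := hN n (by omega) (n, ⟨c, hc⟩) rfl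
  have hF := blochBound_logBlock n hc
  have i0 := h0 z hz
  have i1 := H₁ _ (fun w hw => hF.norm_deriv_le hw) h1 z hz
  have i2 := H₂ _ (fun w hw => hF.norm_deriv_deriv_le hw) h2 z hz
  have hv := weight_nonneg β hz
  rw [deriv_deriv_wcomp hu hφ hφm hF.diff hz] at i0
  set V := (1 - ‖z‖ ^ 2) ^ β
  have hA : V * ‖deriv (deriv u) z * logBlock n c (φ z)‖ ≤ ε / 6 := by
    have htri : ∀ a b d : ℂ, ‖a‖ ≤ ‖a + b + d‖ + ‖b‖ + ‖d‖ := fun a b d => by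
      have h3 := norm_sub_le (a + b + d - b) d
      have h4 := norm_sub_le (a + b + d) b
      have h5 : a + b + d - b - d = a := by ring
      rw [h5] at h3
      linarith
    have := mul_le_mul_of_nonneg_left (htri (deriv (deriv u) z * logBlock n c (φ z))
      (coeffOne u φ z * deriv (logBlock n c) (φ z))
      (coeffTwo u φ z * deriv (deriv (logBlock n c)) (φ z))) hv
    linarith
  rw [norm_mul] at hA
  have hlogm : Real.log m ≤ 3 * Real.log n := by
    refine le_trans ?_ (two_mul_log_succ_le (by omega))
    have hmpos : (0 : ℝ) < m := by
      have : 0 < m := lt_of_lt_of_le (by positivity) hm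
      exact_mod_cast this
    have h3 : Real.log m ≤ Real.log (((n : ℝ) + 1) ^ 2) :=
      Real.log_le_log hmpos (by exact_mod_cast hmn.le)
    rw [Real.log_pow] at h3
    exact_mod_cast h3
  have hlogn := Real.log_natCast_nonneg n
  have hpow := pow_le_pow_of_le_one (norm_nonneg (φ z)) hp hnm
  calc Real.log m * (V * ‖deriv (deriv u) z‖ * ‖φ z‖ ^ m)
      ≤ 3 * Real.log n * (V * ‖deriv (deriv u) z‖ * ‖φ z‖ ^ (n ^ 2)) := by gcongr
    _ = 3 * (V * ‖deriv (deriv u) z‖) * (Real.log n * ‖φ z‖ ^ (n ^ 2)) := by ring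
    _ ≤ 3 * (V * ‖deriv (deriv u) z‖) * (2 * ‖logBlock n c (φ z)‖) := by gcongr
    _ ≤ ε := by linarith

/-- **Corollary 4.6 (ii)**. `uC_φ : B → Z_β` is compact iff it is bounded,
`(n+1) ‖(2u'φ'+uφ'')φ^n‖_ν_β → 0`, `(n+1)² ‖u(φ')²φ^n‖_ν_β → 0` and
`(log n) ‖u''φ^n‖_ν_β → 0`. -/
theorem weighted_comp_compact_Bloch_to_Zygmund_iff_of_eq_one
    (β : ℝ) (hβ : 0 < β)
    (u φ : ℂ → ℂ) (hu : DifferentiableOn ℂ u unitDisk)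
    (hφd : DifferentiableOn ℂ φ unitDisk) (hφm : Set.MapsTo φ unitDisk unitDisk) :
    CompactBlochToZygmund 1 β u φ ↔
      BoundedBlochToZygmund 1 β u φ ∧
      Filter.Tendsto (fun n : ℕ => ((n : ℝ) + 1) * wnorm β (fun z => (2 * deriv u z * deriv φ z + u z * deriv (deriv φ) z) * φ z ^ n))
        Filter.atTop (nhds 0) ∧
      Filter.Tendsto (fun n : ℕ => ((n : ℝ) + 1) ^ 2 * wnorm β (fun z => u z * deriv φ z ^ 2 * φ z ^ n))
        Filter.atTop (nhds 0) ∧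
      Filter.Tendsto (fun n : ℕ => Real.log n * wnorm β (fun z => deriv (deriv u) z * φ z ^ n))
        Filter.atTop (nhds 0) := by
  have hpow : BoundedBlochToZygmund 1 β u φ →
      ((NullPow β φ (coeffOne u φ) (fun n => (n : ℝ) + 1) ∧
        NullPow β φ (coeffTwo u φ) (fun n => ((n : ℝ) + 1) ^ 2) ∧
        NullPow β φ (deriv (deriv u)) (fun n => Real.log n)) ↔ _) := fun h => by
    obtain ⟨bA, bB, bC⟩ := h.exists_bound hu hφd hφm
    exact and_congr (nullPow_iff_tendsto hφm bB fun n => by positivity)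
      (and_congr (nullPow_iff_tendsto hφm bC fun n => by positivity)
        (nullPow_iff_tendsto hφm bA fun n => Real.log_natCast_nonneg n))
  constructor
  · intro h
    obtain ⟨nB, nC⟩ := h.nullPow_coeff hu hφd hφm
    exact ⟨h.1, (hpow h.1).1 ⟨nB, nC, h.nullPow_log hu hφd hφm⟩⟩
  · rintro ⟨h, hlim⟩
    obtain ⟨nB, nC, nA⟩ := (hpow h).2 hlim
    exact compact_of_nullTail h hu hφd hφm (nA.nullTail_log hφm) (nB.nullTail_inv hφm)
      (nC.nullTail_inv_sq hφm)

end
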